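/- arXiv:2603.19977 — 2 statements merged into one kernel-verified Lean document; each statement's English description precedes it below -/
import Mathlib

section
/- Let n ≥ 1, let s₁,…,sₙ ∈ ℝ² be training locations and s⋆ ∈ ℝ² a predictive location, and let c(s,s') = η²·ρ(‖s−s'‖₂) be a stationary isotropic covariance kernel. Assume the Gram matrix C = (c(sᵢ,sⱼ))ᵢ,ⱼ is positive semidefinite and τ² > 0. Then the matrix C + τ²Iₙ is invertible, and the influence vector of the full Gaussian process predictive mean, 𝓘(s⋆) = (C + τ²Iₙ)⁻¹ c_{n⋆} where c_{n⋆} = (c(sᵢ, s⋆))ᵢ₌₁ⁿ, satisfies ‖𝓘(s⋆)‖∞ ≤ (√n / τ²) · c(s_{𝒩(s⋆)}, s⋆), where s_{𝒩(s⋆)} = argmin_{s ∈ {s₁,…,sₙ}} ‖s − s⋆‖₂ is the nearest training location to s⋆. -/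
open Matrix

/-- Adding a nonnegative ridge `t` to a positive semidefinite matrix bounds it below by `t`. -/
theorem Matrix.PosSemidef.sq_mul_dotProduct_le_add_smul_one {ι : Type*} [Fintype ι]
    [DecidableEq ι] {C : Matrix ι ι ℝ} (hC : C.PosSemidef) {t : ℝ} (ht : 0 ≤ t) (x : ι → ℝ) :
    t ^ 2 * (x ⬝ᵥ x) ≤ ((C + t • (1 : Matrix ι ι ℝ)) *ᵥ x) ⬝ᵥ ((C + t • (1 : Matrix ι ι ℝ)) *ᵥ x) := by
  have hquad : 0 ≤ x ⬝ᵥ (C *ᵥ x) := by simpa using hC.dotProduct_mulVec_nonneg x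
  have hsq : 0 ≤ (C *ᵥ x) ⬝ᵥ (C *ᵥ x) := Finset.sum_nonneg fun i _ => mul_self_nonneg _
  simp only [add_mulVec, smul_mulVec, one_mulVec, add_dotProduct, dotProduct_add, smul_dotProduct,
    dotProduct_smul, smul_eq_mul, dotProduct_comm (C *ᵥ x) x]
  nlinarith [mul_nonneg ht hquad]

/-- **GP influence bound.** For a stationary isotropic covariance kernel
`c(s,s') = η² ρ(‖s-s'‖)` on ℝ², a positive semidefinite Gram matrix `C` and nugget
variance `τ² > 0`, the matrix `C + τ² Iₙ` is invertible and the influence vector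
`𝓘(s⋆) = (C + τ² Iₙ)⁻¹ c_{n⋆}` of the full GP predictive mean satisfies
`‖𝓘(s⋆)‖∞ ≤ (√n / τ²) · c(s_{𝒩(s⋆)}, s⋆)`, where `s_{𝒩(s⋆)}` is the nearest
training location to the test location `s⋆`. -/
theorem gp_influence_bound
    (n : ℕ) (hn : 1 ≤ n)
    (s : Fin n → EuclideanSpace ℝ (Fin 2)) (sstar : EuclideanSpace ℝ (Fin 2))
    (η2 : ℝ) (hη2 : 0 < η2)
    (ρ : ℝ → ℝ)
    (hρ_anti : ∀ a b : ℝ, 0 ≤ a → a ≤ b → ρ b ≤ ρ a)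
    (hρ0 : ρ 0 = 1)
    (hρ_mem : ∀ r : ℝ, 0 ≤ r → ρ r ∈ Set.Icc (0 : ℝ) 1)
    (C : Matrix (Fin n) (Fin n) ℝ)
    (hC : ∀ i j, C i j = η2 * ρ (dist (s i) (s j)))
    (hCpsd : C.PosSemidef)
    (τ2 : ℝ) (hτ2 : 0 < τ2)
    (cstar : Fin n → ℝ) (hcstar : ∀ i, cstar i = η2 * ρ (dist (s i) sstar))
    (i0 : Fin n) (hi0 : ∀ j, dist (s i0) sstar ≤ dist (s j) sstar) :
    IsUnit (C + τ2 • (1 : Matrix (Fin n) (Fin n) ℝ)) ∧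
      ∀ i : Fin n,
        |((C + τ2 • (1 : Matrix (Fin n) (Fin n) ℝ))⁻¹ *ᵥ cstar) i| ≤
          (Real.sqrt n / τ2) * (η2 * ρ (dist (s i0) sstar)) := by
  have hunit : IsUnit (C + τ2 • (1 : Matrix (Fin n) (Fin n) ℝ)) :=
    (PosDef.posSemidef_add hCpsd (PosDef.one.smul hτ2)).isUnit
  refine ⟨hunit, fun i => ?_⟩
  set A := C + τ2 • (1 : Matrix (Fin n) (Fin n) ℝ) with hA
  set M := η2 * ρ (dist (s i0) sstar)
  set x := A⁻¹ *ᵥ cstar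
  have hAx : A *ᵥ x = cstar := by
    rw [mulVec_mulVec, mul_nonsing_inv _ ((isUnit_iff_isUnit_det A).mp hunit), one_mulVec]
  have hM : 0 ≤ M := mul_nonneg hη2.le (hρ_mem _ dist_nonneg).1
  have hcstar_sq : cstar ⬝ᵥ cstar ≤ n * M ^ 2 := by
    have hle (j : Fin n) : cstar j * cstar j ≤ M ^ 2 := by
      have hnonneg : 0 ≤ cstar j := by
        rw [hcstar]
        exact mul_nonneg hη2.le (hρ_mem _ dist_nonneg).1
      have hub : cstar j ≤ M := by
        rw [hcstar]
        exact mul_le_mul_of_nonneg_left (hρ_anti _ _ dist_nonneg (hi0 j)) hη2.le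
      nlinarith
    simpa [dotProduct] using Finset.sum_le_sum fun j (_ : j ∈ Finset.univ) => hle j
  have hridge : τ2 ^ 2 * (x ⬝ᵥ x) ≤ cstar ⬝ᵥ cstar := by
    simpa only [← hA, hAx] using hCpsd.sq_mul_dotProduct_le_add_smul_one hτ2.le x
  have hcoord : x i ^ 2 ≤ x ⬝ᵥ x := by
    rw [sq]
    exact Finset.single_le_sum (f := fun j => x j * x j) (fun j _ => mul_self_nonneg _)
      (Finset.mem_univ i)
  have hbound : |τ2 * x i| ≤ Real.sqrt n * M := by
    refine abs_le_of_sq_le_sq ?_ (by positivity)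
    rw [mul_pow, mul_pow, Real.sq_sqrt n.cast_nonneg]
    nlinarith [mul_le_mul_of_nonneg_left hcoord (sq_nonneg τ2)]
  rw [abs_mul, abs_of_pos hτ2] at hbound
  rw [div_mul_eq_mul_div, le_div_iff₀ hτ2, mul_comm]
  exact hbound
end

section
/- Let n, m ≥ 1, let s₁,…,sₙ ∈ ℝ² be training locations, s̃₁,…,s̃ₘ ∈ ℝ² inducing points, and s⋆ ∈ ℝ² a predictive location, and let c(s,s') = η²·ρ(‖s−s'‖₂) be a stationary isotropic covariance kernel. Let A = C_{nm} = (c(sᵢ, s̃ⱼ)) be the n×m cross-covariance matrix, let B = C_{mm} = (c(s̃ᵢ, s̃ⱼ)) be the m×m inducing-point Gram matrix, assumed symmetric positive semidefinite, and let τ² > 0. Assume all eigenvalues of n⁻¹AᵀA lie in the interval (e_min, e_max) with 0 < e_min < e_max < ∞. Then τ²B + AᵀA is invertible, and the influence vector of the predictive-process predictive mean, 𝓘ₘ(s⋆) = A(τ²B + AᵀA)⁻¹ c_{⋆m}ᵀ where c_{⋆m} = (c(s⋆, s̃ⱼ))ⱼ₌₁ᵐ, satisfies ‖𝓘ₘ(s⋆)‖∞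 ≤ (m√m · η² / (n·e_min)) · c(s̃_{𝒩(s⋆)}, s⋆), where s̃_{𝒩(s⋆)} = argmin_{s̃ ∈ {s̃₁,…,s̃ₘ}} ‖s̃ − s⋆‖₂ is the nearest inducing point to s⋆. -/
open Matrix

section Coercive

variable {ι : Type*} [Fintype ι]

theorem dotProduct_self_le_card_mul_sq {v : ι → ℝ} {b : ℝ} (hv : ∀ j, |v j| ≤ b) :
    v ⬝ᵥ v ≤ Fintype.card ι * b ^ 2 := by
  have h : v ⬝ᵥ v ≤ ∑ _j : ι, b ^ 2 := by
    refine Finset.sum_le_sum fun j _ => ?_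
    rw [← sq]
    exact sq_le_sq' (abs_le.mp (hv j)).1 (abs_le.mp (hv j)).2
  simpa using h

theorem sq_dotProduct_le (v w : ι → ℝ) : (v ⬝ᵥ w) ^ 2 ≤ (v ⬝ᵥ v) * (w ⬝ᵥ w) := by
  simpa [dotProduct, sq] using Finset.sum_mul_sq_le_sq_mul_sq Finset.univ v w

theorem isUnit_of_coercive [DecidableEq ι] {M : Matrix ι ι ℝ} {κ : ℝ} (hκ : 0 < κ)
    (hM : ∀ x : ι → ℝ, κ * (x ⬝ᵥ x) ≤ x ⬝ᵥ (M *ᵥ x)) : IsUnit M := by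
  rw [← mulVec_injective_iff_isUnit]
  refine (injective_iff_map_eq_zero M.mulVecLin).2 fun x hx => ?_
  have h := hM x
  rw [mulVecLin_apply] at hx
  rw [hx, dotProduct_zero] at h
  have h0 : 0 ≤ x ⬝ᵥ x := Finset.sum_nonneg fun j _ => mul_self_nonneg (x j)
  exact dotProduct_self_eq_zero.1 (le_antisymm (by nlinarith) h0)

theorem sq_mul_dotProduct_self_le_of_coercive {M : Matrix ι ι ℝ} {κ : ℝ} (hκ : 0 < κ)
    (hM : ∀ x : ι → ℝ, κ * (x ⬝ᵥ x) ≤ x ⬝ᵥ (M *ᵥ x)) (w : ι → ℝ) :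
    κ ^ 2 * (w ⬝ᵥ w) ≤ (M *ᵥ w) ⬝ᵥ (M *ᵥ w) := by
  have h0 : 0 ≤ w ⬝ᵥ w := Finset.sum_nonneg fun j _ => mul_self_nonneg (w j)
  have h1 : 0 ≤ (M *ᵥ w) ⬝ᵥ (M *ᵥ w) := Finset.sum_nonneg fun j _ => mul_self_nonneg _
  have h2 : (κ * (w ⬝ᵥ w)) ^ 2 ≤ (w ⬝ᵥ w) * ((M *ᵥ w) ⬝ᵥ (M *ᵥ w)) :=
    (pow_le_pow_left₀ (by positivity) (hM w) 2).trans (sq_dotProduct_le _ _)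
  rcases h0.eq_or_lt with h | h
  · simpa [← h] using h1
  · exact le_of_mul_le_mul_left (by linarith) h

/-- If `M` is coercive with constant `κ`, the solution `M⁻¹ c` paired with a vector `a` is
controlled by entrywise bounds on `a` and `c`. -/
theorem abs_dotProduct_inv_mulVec_le [DecidableEq ι] {M : Matrix ι ι ℝ} {κ : ℝ} (hκ : 0 < κ)
    (hM : ∀ x : ι → ℝ, κ * (x ⬝ᵥ x) ≤ x ⬝ᵥ (M *ᵥ x)) {a c : ι → ℝ} {α γ : ℝ}
    (hα : 0 ≤ α) (hγ : 0 ≤ γ) (ha : ∀ j, |a j| ≤ α) (hc : ∀ j, |c j| ≤ γ) :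
    |a ⬝ᵥ (M⁻¹ *ᵥ c)| ≤ Fintype.card ι * α / κ * γ := by
  have hdet := (isUnit_iff_isUnit_det M).1 (isUnit_of_coercive hκ hM)
  set w := M⁻¹ *ᵥ c
  have hMw : M *ᵥ w = c := by simp [w, mulVec_mulVec, mul_nonsing_inv M hdet]
  have hw := sq_mul_dotProduct_self_le_of_coercive hκ hM w
  rw [hMw] at hw
  have h0 : 0 ≤ w ⬝ᵥ w := Finset.sum_nonneg fun j _ => mul_self_nonneg (w j)
  have hmul : κ * |a ⬝ᵥ w| ≤ Fintype.card ι * α * γ := by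
    refine abs_le_of_sq_le_sq' ?_ (by positivity) |>.2
    calc (κ * |a ⬝ᵥ w|) ^ 2 = κ ^ 2 * (a ⬝ᵥ w) ^ 2 := by rw [mul_pow, sq_abs]
      _ ≤ κ ^ 2 * ((a ⬝ᵥ a) * (w ⬝ᵥ w)) := by gcongr; exact sq_dotProduct_le a w
      _ = (a ⬝ᵥ a) * (κ ^ 2 * (w ⬝ᵥ w)) := by ring
      _ ≤ (Fintype.card ι * α ^ 2) * (Fintype.card ι * γ ^ 2) :=
        mul_le_mul (dotProduct_self_le_card_mul_sq ha)
          (hw.trans (dotProduct_self_le_card_mul_sq hc)) (by positivity) (by positivity)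
      _ = (Fintype.card ι * α * γ) ^ 2 := by ring
  rw [div_mul_eq_mul_div, le_div_iff₀ hκ]
  linarith

end Coercive

/-- **PP influence bound.** For a stationary isotropic covariance kernel
`c(s,s') = η² ρ(‖s-s'‖)` on ℝ², cross-covariance matrix `A = C_{nm}`,
positive semidefinite inducing-point Gram matrix `B = C_{mm}`, nugget `τ² > 0`,
and all eigenvalues of `n⁻¹AᵀA` in `(e_min, e_max)` (stated equivalently via the
quadratic form, since `AᵀA` is symmetric), the matrix `τ²B + AᵀA` is invertible
and the influence vector `𝓘ₘ(s⋆) = A(τ²B + AᵀA)⁻¹ c_{⋆m}ᵀ` of the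
predictive-process predictive mean satisfies
`‖𝓘ₘ(s⋆)‖∞ ≤ (m√m η² / (n e_min)) · c(s̃_{𝒩(s⋆)}, s⋆)`, where `s̃_{𝒩(s⋆)}`
is the nearest inducing point to `s⋆`. -/
theorem pp_influence_bound
    (n m : ℕ) (hn : 1 ≤ n) (hm : 1 ≤ m)
    (s : Fin n → EuclideanSpace ℝ (Fin 2))
    (st : Fin m → EuclideanSpace ℝ (Fin 2))
    (sstar : EuclideanSpace ℝ (Fin 2))
    (η2 : ℝ) (hη2 : 0 < η2)
    (ρ : ℝ → ℝ)
    (hρ_anti : ∀ a b : ℝ, 0 ≤ a → a ≤ b → ρ b ≤ ρ a)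
    (hρ0 : ρ 0 = 1)
    (hρ_mem : ∀ r : ℝ, 0 ≤ r → ρ r ∈ Set.Icc (0 : ℝ) 1)
    (A : Matrix (Fin n) (Fin m) ℝ)
    (hA : ∀ i j, A i j = η2 * ρ (dist (s i) (st j)))
    (B : Matrix (Fin m) (Fin m) ℝ)
    (hB : ∀ i j, B i j = η2 * ρ (dist (st i) (st j)))
    (hBpsd : B.PosSemidef)
    (τ2 : ℝ) (hτ2 : 0 < τ2)
    (emin emax : ℝ) (hemin : 0 < emin) (hee : emin < emax)
    (heig : ∀ x : Fin m → ℝ, x ≠ 0 →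
      emin * (x ⬝ᵥ x) < (n : ℝ)⁻¹ * (x ⬝ᵥ ((Aᵀ * A) *ᵥ x)) ∧
        (n : ℝ)⁻¹ * (x ⬝ᵥ ((Aᵀ * A) *ᵥ x)) < emax * (x ⬝ᵥ x))
    (cstar : Fin m → ℝ) (hcstar : ∀ j, cstar j = η2 * ρ (dist sstar (st j)))
    (j0 : Fin m) (hj0 : ∀ j, dist (st j0) sstar ≤ dist (st j) sstar) :
    IsUnit (τ2 • B + Aᵀ * A) ∧
      ∀ i : Fin n,
        |(A *ᵥ ((τ2 • B + Aᵀ * A)⁻¹ *ᵥ cstar)) i| ≤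
          ((m : ℝ) * Real.sqrt m * η2 / ((n : ℝ) * emin)) *
            (η2 * ρ (dist (st j0) sstar)) := by
  have hn0 : (0 : ℝ) < n := by exact_mod_cast hn
  have hκ : 0 < (n : ℝ) * emin := by positivity
  have hM : ∀ x : Fin m → ℝ, (n : ℝ) * emin * (x ⬝ᵥ x) ≤ x ⬝ᵥ ((τ2 • B + Aᵀ * A) *ᵥ x) := by
    intro x
    rcases eq_or_ne x 0 with rfl | hx
    · simp
    have h1 := (heig x hx).1
    rw [lt_inv_mul_iff₀ hn0] at h1
    have h2 : 0 ≤ x ⬝ᵥ (B *ᵥ x) := by simpa using hBpsd.dotProduct_mulVec_nonneg x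
    have h3 := mul_nonneg hτ2.le h2
    rw [add_mulVec, dotProduct_add, smul_mulVec, dotProduct_smul, smul_eq_mul]
    linarith
  refine ⟨isUnit_of_coercive hκ hM, fun i => ?_⟩
  have hρj0 := (hρ_mem (dist (st j0) sstar) dist_nonneg).1
  have ha : ∀ j, |A i j| ≤ η2 := fun j => by
    obtain ⟨h0, h1⟩ := hρ_mem (dist (s i) (st j)) dist_nonneg
    rw [hA, abs_of_nonneg (by positivity)]
    exact mul_le_of_le_one_right hη2.le h1
  have hc : ∀ j, |cstar j| ≤ η2 * ρ (dist (st j0) sstar) := fun j => by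
    have h0 := (hρ_mem (dist sstar (st j)) dist_nonneg).1
    rw [hcstar, abs_of_nonneg (by positivity), dist_comm sstar]
    exact mul_le_mul_of_nonneg_left (hρ_anti _ _ dist_nonneg (hj0 j)) hη2.le
  refine (abs_dotProduct_inv_mulVec_le hκ hM hη2.le (by positivity) ha hc).trans ?_
  rw [Fintype.card_fin]
  have hsqrt : 1 ≤ Real.sqrt m := Real.one_le_sqrt.2 (by exact_mod_cast hm)
  gcongr
  exact le_mul_of_one_le_right (by positivity) hsqrt
end
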